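/- $QA_{\varphi,\psi}$ embeds continuously into the Lorentz space $\Lambda_\varphi$ with embedding norm at most $1/\psi(1)$: for every measurable function $f$ on $[0,1]$, $\psi(1)\,\|f\|_{\Lambda_\varphi}\le \|f\|_{\varphi,\psi}$. -/

import Mathlib

open MeasureTheory ENNReal Set Filter Topology

noncomputable section

/-- Lebesgue measure restricted to the interval `[0,1]`. -/
def μ01 : Measure ℝ := volume.restrict (Set.Icc 0 1)

/-- `φ : [0,1] → [0,∞)` is concave, non-decreasing, and vanishes only at the origin. -/
structure IsPhi (φ : ℝ → ℝ) : Prop where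
  concave : ConcaveOn ℝ (Set.Icc 0 1) φ
  mono : MonotoneOn φ (Set.Icc 0 1)
  zero : φ 0 = 0
  pos : ∀ t : ℝ, 0 < t → t ≤ 1 → 0 < φ t

/-- `ψ : [0,∞) → [0,∞)` is concave, non-decreasing, and vanishes only at the origin. -/
structure IsPsi (ψ : ℝ → ℝ) : Prop where
  concave : ConcaveOn ℝ (Set.Ici 0) ψ
  mono : MonotoneOn ψ (Set.Ici 0)
  zero : ψ 0 = 0
  pos : ∀ t : ℝ, 0 < t → 0 < ψ t

/-- A sequence `g` of nonnegative `L^∞` functions with `|f| ≤ ∑ₙ gₙ` a.e. -/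
def Admissible (f : ℝ → ℝ) (g : ℕ → ℝ → ℝ) : Prop :=
  (∀ n, AEMeasurable (g n) μ01) ∧
  (∀ n, eLpNorm (g n) ⊤ μ01 < ⊤) ∧
  (∀ n x, 0 ≤ g n x) ∧
  (∀ᵐ x ∂μ01, ENNReal.ofReal |f x| ≤ ∑' n : ℕ, ENNReal.ofReal (g n x))

/-- The cost `∑ₙ ψ(n) ‖gₙ‖_∞ φ(‖gₙ‖₁/‖gₙ‖_∞)` of a decomposition (index shifted by 1;
`0/0 = 0` by the `ℝ≥0∞` division convention, and `φ 0 = 0`). -/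
def seqCost (φ ψ : ℝ → ℝ) (g : ℕ → ℝ → ℝ) : ℝ≥0∞ :=
  ∑' n : ℕ, ENNReal.ofReal
    (ψ ((n : ℝ) + 1) * (eLpNorm (g n) ⊤ μ01).toReal *
      φ ((eLpNorm (g n) 1 μ01 / eLpNorm (g n) ⊤ μ01).toReal))

/-- The quasi-norm `‖f‖_{φ,ψ}` (equal to `∞` when no admissible decomposition exists). -/
def QANorm (φ ψ : ℝ → ℝ) (f : ℝ → ℝ) : ℝ≥0∞ :=
  ⨅ (g : ℕ → ℝ → ℝ) (_ : Admissible f g), seqCost φ ψ g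

/-- Membership in the space `QA_{φ,ψ}`. -/
def MemQA (φ ψ : ℝ → ℝ) (f : ℝ → ℝ) : Prop :=
  AEMeasurable f μ01 ∧ QANorm φ ψ f < ⊤

/-- The decreasing rearrangement `f*` of `f` on `[0,1]`. -/
def decRearr (f : ℝ → ℝ) (t : ℝ) : ℝ :=
  sInf {s : ℝ | 0 ≤ s ∧ μ01 {x | s < |f x|} ≤ ENNReal.ofReal t}

/-- The limit `ζ(0⁺)` of a non-decreasing function `ζ` on `[0,1]`. -/
def limZero (ζ : ℝ → ℝ) : ℝ := sInf (ζ '' Set.Ioc 0 1)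

/-- The Lorentz norm `‖f‖_{Λ_ζ} = ∫₀¹ f* dζ = ‖f‖_∞ ζ(0⁺) + ∫₀¹ f*(s) ζ'(s) ds`
(for `ζ` concave the derivative exists a.e. and `ζ` is absolutely continuous on `(0,1]`). -/
def lorentzNorm (ζ : ℝ → ℝ) (f : ℝ → ℝ) : ℝ≥0∞ :=
  eLpNorm f ⊤ μ01 * ENNReal.ofReal (limZero ζ) +
    ∫⁻ s in Set.Ioc (0:ℝ) 1, ENNReal.ofReal (decRearr f s * deriv ζ s)

/-- Membership in the Lorentz space `Λ_ζ`. -/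
def MemLorentz (ζ : ℝ → ℝ) (f : ℝ → ℝ) : Prop :=
  AEMeasurable f μ01 ∧ lorentzNorm ζ f < ⊤

/-- The quasi-concave function `φ_s(t) = inf_n max{sₙ,t} (φ(sₙ)/sₙ) ψ(n)` (index shifted by 1). -/
def phiSeq (φ ψ : ℝ → ℝ) (s : ℕ → ℝ) (t : ℝ) : ℝ :=
  if t = 0 then 0 else ⨅ n : ℕ, max (s n) t * (φ (s n) / s n) * ψ ((n : ℝ) + 1)

/-- The function `τ(t) = φ(t) ψ(logbar(φ(t)/t))` with `logbar t = 1 + log⁺ t`. -/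
def tauF (φ ψ : ℝ → ℝ) (t : ℝ) : ℝ :=
  if t = 0 then 0 else φ t * ψ (1 + max (Real.log (φ t / t)) 0)



theorem hardy_aux {F G : ℝ → ℝ≥0∞} {h : ℝ → ℝ}
    (hF : AEMeasurable F (volume.restrict (Ioo (0:ℝ) 1)))
    (hG : AEMeasurable G (volume.restrict (Ioo (0:ℝ) 1)))
    (hh : AntitoneOn h (Ioo 0 1)) (h0 : ∀ x ∈ Ioo (0:ℝ) 1, 0 ≤ h x)
    (H : ∀ t : ℝ, 0 < t → t ≤ 1 → ∫⁻ s in Ioc 0 t, F s ≤ ∫⁻ s in Ioc 0 t, G s) :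
    ∫⁻ s in Ioo (0:ℝ) 1, F s * ENNReal.ofReal (h s) ≤
      ∫⁻ s in Ioo (0:ℝ) 1, G s * ENNReal.ofReal (h s) := by
  have hm : AEMeasurable h (volume.restrict (Ioo (0:ℝ) 1)) :=
    aemeasurable_restrict_of_antitoneOn measurableSet_Ioo hh
  have hn : 0 ≤ᵐ[volume.restrict (Ioo (0:ℝ) 1)] h :=
    (ae_restrict_iff' measurableSet_Ioo).2 (ae_of_all _ h0)
  have key : ∀ K : ℝ → ℝ≥0∞, AEMeasurable K (volume.restrict (Ioo (0:ℝ) 1)) →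
      ∫⁻ s in Ioo (0:ℝ) 1, K s * ENNReal.ofReal (h s) =
      ∫⁻ y in Ioi (0:ℝ), ∫⁻ s in {a | y < h a} ∩ Ioo 0 1, K s := by
    intro K hK
    have ac := withDensity_absolutelyContinuous (volume.restrict (Ioo (0:ℝ) 1)) K
    have e1 := lintegral_withDensity_eq_lintegral_mul₀ hK hm.ennreal_ofReal
    have e2 := lintegral_eq_lintegral_meas_lt ((volume.restrict (Ioo (0:ℝ) 1)).withDensity K)
      (ac.ae_le hn) (hm.mono_ac ac)
    simp only [Pi.mul_apply] at e1
    rw [← e1, e2]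
    simp_rw [withDensity_apply', Measure.restrict_restrict' measurableSet_Ioo]
  rw [key F hF, key G hG]
  refine lintegral_mono fun y => ?_
  set S := {a | y < h a} ∩ Ioo 0 1 with hS
  rcases S.eq_empty_or_nonempty with he | ⟨x, hx⟩
  · simp [he]
  have hb : BddAbove S := ⟨1, fun z hz => hz.2.2.le⟩
  have hxt : x ≤ sSup S := le_csSup hb hx
  have ht1 : sSup S ≤ 1 := csSup_le ⟨x, hx⟩ fun z hz => hz.2.2.le
  have ht0 : 0 < sSup S := hx.2.1.trans_le hxt
  calc ∫⁻ s in S, F s ≤ ∫⁻ s in Ioc 0 (sSup S), F s :=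
        lintegral_mono_set fun z hz => ⟨hz.2.1, le_csSup hb hz⟩
    _ ≤ ∫⁻ s in Ioc 0 (sSup S), G s := H _ ht0 ht1
    _ = ∫⁻ s in Ioo 0 (sSup S), G s := by rw [restrict_Ioo_eq_restrict_Ioc]
    _ ≤ ∫⁻ s in S, G s := by
        refine lintegral_mono_set fun z hz => ?_
        obtain ⟨w, hw, hzw⟩ := exists_lt_of_lt_csSup ⟨x, hx⟩ hz.2
        have hz1 : z ∈ Ioo (0:ℝ) 1 := ⟨hz.1, hzw.trans hw.2.2⟩
        exact ⟨lt_of_lt_of_le hw.1 (hh hz1 hw.2 hzw.le), hz1⟩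

theorem decRearr_nonempty {f : ℝ → ℝ} (hf : AEMeasurable f μ01) {t : ℝ} (ht : 0 < t) :
    {s : ℝ | 0 ≤ s ∧ μ01 {x | s < |f x|} ≤ ENNReal.ofReal t}.Nonempty := by
  have hfin : IsFiniteMeasure μ01 := by unfold μ01; infer_instance
  have : Tendsto (fun n : ℕ => μ01 {x | (n:ℝ) < |f x|}) atTop (𝓝 (μ01 (⋂ n : ℕ, {x | (n:ℝ) < |f x|}))) := by
    refine tendsto_measure_iInter_atTop ?_ ?_ ⟨0, measure_ne_top _ _⟩
    · intro n
      exact nullMeasurableSet_lt aemeasurable_const (by fun_prop)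
    · intro a b hab x hx
      have hx : (b:ℝ) < |f x| := hx
      show (a:ℝ) < |f x|
      exact lt_of_le_of_lt (Nat.cast_le.2 hab) hx
  have he : (⋂ n : ℕ, {x | (n:ℝ) < |f x|}) = ∅ := by
    ext x
    simp only [mem_iInter, mem_setOf_eq, mem_empty_iff_false, iff_false, not_forall, not_lt]
    exact exists_nat_ge _
  rw [he, measure_empty] at this
  have h2 := this.eventually (Iic_mem_nhds (ENNReal.ofReal_pos.2 ht))
  obtain ⟨n, hn⟩ := h2.exists
  exact ⟨n, Nat.cast_nonneg n, hn⟩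

theorem decRearr_nonneg (f : ℝ → ℝ) (t : ℝ) : 0 ≤ decRearr f t :=
  Real.sInf_nonneg fun _ hx => hx.1

theorem decRearr_anti {f : ℝ → ℝ} (hf : AEMeasurable f μ01) :
    AntitoneOn (decRearr f) (Ioi 0) := by
  intro a ha b hb hab
  refine csInf_le_csInf ⟨0, fun x hx => hx.1⟩ (decRearr_nonempty hf ha) ?_
  intro s hs
  exact ⟨hs.1, hs.2.trans (ENNReal.ofReal_le_ofReal hab)⟩

theorem lt_of_lt_decRearr {f : ℝ → ℝ} {t y : ℝ} (hy : 0 ≤ y)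
    (h : y < decRearr f t) : ENNReal.ofReal t < μ01 {x | y < |f x|} := by
  by_contra hc
  push Not at hc
  have hb : BddBelow {s : ℝ | 0 ≤ s ∧ μ01 {x | s < |f x|} ≤ ENNReal.ofReal t} :=
    ⟨0, fun x hx => hx.1⟩
  have hm : y ∈ {s : ℝ | 0 ≤ s ∧ μ01 {x | s < |f x|} ≤ ENNReal.ofReal t} := ⟨hy, hc⟩
  exact absurd (csInf_le hb hm) (not_le.2 h)

theorem decRearr_sub {f : ℝ → ℝ} (hf : AEMeasurable f μ01) {l : ℝ} (hl : 0 ≤ l) :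
    ∫⁻ s in Ioc (0:ℝ) 1, ENNReal.ofReal (decRearr f s - l) ≤
      ∫⁻ x, ENNReal.ofReal (|f x| - l) ∂μ01 := by
  have hm : AEMeasurable (decRearr f) (volume.restrict (Ioc (0:ℝ) 1)) :=
    aemeasurable_restrict_of_antitoneOn measurableSet_Ioc
      ((decRearr_anti hf).mono fun x hx => hx.1)
  have e1 : ∀ r : ℝ, ENNReal.ofReal r = ENNReal.ofReal (max r 0) := by
    intro r
    rcases le_total r 0 with h | h
    · rw [max_eq_right h, ENNReal.ofReal_of_nonpos h, ENNReal.ofReal_zero]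
    · rw [max_eq_left h]
  simp_rw [e1 (decRearr f _ - l), e1 (|f _| - l)]
  rw [lintegral_eq_lintegral_meas_lt (f := fun s => max (decRearr f s - l) 0) _
      (ae_of_all _ fun x => le_max_right _ _) ((hm.sub_const l).max aemeasurable_const),
    lintegral_eq_lintegral_meas_lt (f := fun x => max (|f x| - l) 0) _
      (ae_of_all _ fun x => le_max_right _ _) (AEMeasurable.max (by fun_prop) aemeasurable_const)]
  refine lintegral_mono_ae ((ae_restrict_iff' measurableSet_Ioi).2 (ae_of_all _ fun y hy => ?_))
  have hy : 0 < y := hy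
  have e2 : ∀ r : ℝ, y < max (r - l) 0 ↔ y + l < r := by
    intro r; rw [lt_max_iff]; constructor
    · rintro (h | h) <;> linarith
    · intro h; left; linarith
  simp_rw [e2]
  have hfin : IsFiniteMeasure μ01 := by unfold μ01; infer_instance
  rw [Measure.restrict_apply' measurableSet_Ioc]
  calc _ ≤ volume (Ioc 0 (μ01 {x | y + l < |f x|}).toReal) := by
        refine measure_mono fun s hs => ⟨hs.2.1, ?_⟩
        have := lt_of_lt_decRearr (by positivity) hs.1
        exact (ENNReal.ofReal_le_iff_le_toReal (measure_ne_top _ _)).1 this.le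
    _ = _ := by
        rw [Real.volume_Ioc, sub_zero, ENNReal.ofReal_toReal (measure_ne_top _ _)]

theorem decRearr_int {f : ℝ → ℝ} (hf : AEMeasurable f μ01) {g : ℕ → ℝ → ℝ}
    (hg : Admissible f g) {t : ℝ} (ht : 0 < t) (ht1 : t ≤ 1) :
    ∫⁻ s in Ioc 0 t, ENNReal.ofReal (decRearr f s) ≤
      ∑' n, min (ENNReal.ofReal t * eLpNorm (g n) ⊤ μ01) (eLpNorm (g n) 1 μ01) := by
  classical
  obtain ⟨g1, g2, g3, g4⟩ := hg
  set A : ℕ → Prop := fun n => ENNReal.ofReal t * eLpNorm (g n) ⊤ μ01 ≤ eLpNorm (g n) 1 μ01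
  set L : ℝ≥0∞ := ∑' n, if A n then eLpNorm (g n) ⊤ μ01 else 0 with hL
  have hsum : ENNReal.ofReal t * L + ∑' n, (if A n then 0 else eLpNorm (g n) 1 μ01) =
      ∑' n, min (ENNReal.ofReal t * eLpNorm (g n) ⊤ μ01) (eLpNorm (g n) 1 μ01) := by
    rw [hL, ← ENNReal.tsum_mul_left, ← ENNReal.tsum_add]
    refine tsum_congr fun n => ?_
    by_cases h : A n
    · simp only [h, if_true, add_zero]; exact (min_eq_left h).symm
    · simp only [h, if_false, mul_zero, zero_add]; exact (min_eq_right (not_le.1 h).le).symm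
  rw [← hsum]
  have ht' : ENNReal.ofReal t ≠ 0 := (ENNReal.ofReal_pos.2 ht).ne'
  by_cases hLt : L = ⊤
  · rw [hLt, ENNReal.mul_top ht', top_add]; exact le_top
  have hb : ∀ᵐ x ∂μ01, ∀ n, ENNReal.ofReal (g n x) ≤ eLpNorm (g n) ⊤ μ01 := by
    rw [ae_all_iff]
    intro n
    rw [eLpNorm_exponent_top]
    filter_upwards [enorm_ae_le_eLpNormEssSup (g n) μ01] with x hx
    rwa [Real.enorm_of_nonneg (g3 n x)] at hx
  have hpt : ∀ᵐ x ∂μ01, ENNReal.ofReal (|f x| - L.toReal) ≤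
      ∑' n, if A n then 0 else ENNReal.ofReal (g n x) := by
    filter_upwards [g4, hb] with x hx hbx
    rw [ENNReal.ofReal_sub _ ENNReal.toReal_nonneg, ENNReal.ofReal_toReal hLt, tsub_le_iff_right]
    refine hx.trans ?_
    rw [hL, ← ENNReal.tsum_add]
    refine ENNReal.tsum_le_tsum fun n => ?_
    by_cases h : A n
    · simpa [h] using hbx n
    · simp [h]
  have h1 := decRearr_sub hf (l := L.toReal) ENNReal.toReal_nonneg
  have h2 : ∫⁻ x, ENNReal.ofReal (|f x| - L.toReal) ∂μ01 ≤
      ∑' n, (if A n then 0 else eLpNorm (g n) 1 μ01) := by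
    refine (lintegral_mono_ae hpt).trans ?_
    rw [lintegral_tsum]
    · refine ENNReal.tsum_le_tsum fun n => ?_
      by_cases h : A n
      · simp [h]
      · simp only [h, if_false]
        rw [eLpNorm_one_eq_lintegral_enorm]
        refine lintegral_mono fun x => ?_
        rw [Real.enorm_of_nonneg (g3 n x)]
    · intro n
      by_cases h : A n
      · simp [h]
      · simpa [h] using (g1 n).ennreal_ofReal
  calc ∫⁻ s in Ioc 0 t, ENNReal.ofReal (decRearr f s)
      ≤ ∫⁻ s in Ioc 0 t, (L + ENNReal.ofReal (decRearr f s - L.toReal)) := by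
        refine lintegral_mono fun s => ?_
        nth_rewrite 1 [← ENNReal.ofReal_toReal hLt]
        refine le_trans ?_ ENNReal.ofReal_add_le
        exact ENNReal.ofReal_le_ofReal (by linarith)
    _ = ENNReal.ofReal t * L + ∫⁻ s in Ioc 0 t, ENNReal.ofReal (decRearr f s - L.toReal) := by
        rw [lintegral_add_left measurable_const]
        simp [mul_comm]
    _ ≤ _ := by
        gcongr
        exact (lintegral_mono_set (Ioc_subset_Ioc_right ht1)).trans (h1.trans h2)

theorem deriv_int {φ : ℝ → ℝ} (hφ : IsPhi φ) {a : ℝ} (ha : 0 < a) (ha1 : a ≤ 1) :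
    ∫⁻ s in Ioc 0 a, ENNReal.ofReal (deriv φ s) ≤ ENNReal.ofReal (φ a - limZero φ) := by
  have hle : ∀ x, 0 < x → x ≤ 1 → limZero φ ≤ φ x := by
    intro x hx hx1
    refine csInf_le ⟨0, ?_⟩ ⟨x, ⟨hx, hx1⟩, rfl⟩
    rintro _ ⟨y, hy, rfl⟩
    exact (hφ.pos y hy.1 hy.2).le
  set χ := Function.update φ 0 (limZero φ) with hχ
  have hne : ∀ x, 0 < x → χ x = φ x := fun x hx => Function.update_of_ne hx.ne' _ _
  have hmono : MonotoneOn χ (uIcc 0 a) := by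
    rw [uIcc_of_le ha.le]
    intro x hx y hy hxy
    rcases hx.1.eq_or_lt with h | h
    · rcases hy.1.eq_or_lt with h' | h'
      · rw [← h, ← h']
      · rw [hne y h', ← h, hχ, Function.update_self]
        exact hle y h' (hy.2.trans ha1)
    · rw [hne x h, hne y (h.trans_le hxy)]
      exact hφ.mono ⟨hx.1, hx.2.trans ha1⟩ ⟨hy.1, hy.2.trans ha1⟩ hxy
  have h1 := hmono.intervalIntegral_deriv_mem_uIcc
  have h2 := hmono.intervalIntegrable_deriv
  have h3 : χ 0 = limZero φ := Function.update_self _ _ _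
  have h4 : 0 ≤ χ a - χ 0 := by
    rw [h3, hne a ha]; linarith [hle a ha ha1]
  rw [uIcc_of_le h4, h3, hne a ha] at h1
  rw [intervalIntegral.integral_of_le ha.le] at h1
  rw [intervalIntegrable_iff_integrableOn_Ioc_of_le ha.le] at h2
  have hd : ∀ s, 0 < s → deriv χ s = deriv φ s := by
    intro s hs
    refine EventuallyEq.deriv_eq ?_
    filter_upwards [lt_mem_nhds hs] with x hx using hne x hx
  have hnn : ∀ᵐ s ∂(volume.restrict (Ioc 0 a)), 0 ≤ deriv χ s := by
    rw [← restrict_Ioo_eq_restrict_Ioc]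
    refine (ae_restrict_iff' measurableSet_Ioo).2 (ae_of_all _ fun s hs => ?_)
    rw [← derivWithin_of_mem_nhds (Icc_mem_nhds hs.1 hs.2)]
    rw [uIcc_of_le ha.le] at hmono
    exact hmono.derivWithin_nonneg
  have h5 := ofReal_integral_eq_lintegral_ofReal h2 hnn
  calc _ = ∫⁻ s in Ioc 0 a, ENNReal.ofReal (deriv χ s) :=
        setLIntegral_congr_fun measurableSet_Ioc fun s hs => by
          show ENNReal.ofReal _ = ENNReal.ofReal _
          rw [hd s hs.1]
    _ ≤ _ := by rw [← h5]; exact ENNReal.ofReal_le_ofReal h1.2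

theorem rightDeriv_facts {φ : ℝ → ℝ} (hφ : IsPhi φ) :
    AntitoneOn (fun x => derivWithin φ (Ioi x) x) (Ioo 0 1) ∧
    (∀ x ∈ Ioo (0:ℝ) 1, 0 ≤ derivWithin φ (Ioi x) x) ∧
    (∀ᵐ x ∂(volume.restrict (Ioo (0:ℝ) 1)), deriv φ x = derivWithin φ (Ioi x) x) := by
  refine ⟨?_, ?_, ?_⟩
  · have h := hφ.concave.neg.monotoneOn_rightDeriv
    rw [interior_Icc] at h
    intro x hx y hy hxy
    have := h hx hy hxy
    simp only [derivWithin.neg] at this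
    simpa using this
  · intro x hx
    have : derivWithin φ (Ioi x) x = derivWithin φ (Ioo x 1) x := by
      refine derivWithin_congr_set ?_
      filter_upwards [lt_mem_nhds hx.1, gt_mem_nhds hx.2] with y hy hy1
      exact propext ⟨fun h => ⟨h, hy1⟩, fun h => h.1⟩
    rw [← derivWithin_inter (Icc_mem_nhds hx.1 hx.2)]
    have hm : MonotoneOn φ (Ioi x ∩ Icc 0 1) := hφ.mono.mono inter_subset_right
    exact hm.derivWithin_nonneg
  · have := (hφ.mono.mono Ioo_subset_Icc_self).ae_differentiableWithinAt measurableSet_Ioo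
    filter_upwards [this, ae_restrict_mem measurableSet_Ioo] with x hx hx1
    exact ((hx.differentiableAt (Ioo_mem_nhds hx1.1 hx1.2)).derivWithin
      (uniqueDiffWithinAt_Ioi x)).symm

theorem lorentz_le {φ : ℝ → ℝ} (hφ : IsPhi φ) {f : ℝ → ℝ} (hf : AEMeasurable f μ01)
    {g : ℕ → ℝ → ℝ} (hg : Admissible f g) :
    lorentzNorm φ f ≤ ∑' n, eLpNorm (g n) ⊤ μ01 *
      ENNReal.ofReal (φ ((eLpNorm (g n) 1 μ01 / eLpNorm (g n) ⊤ μ01).toReal)) := by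
  have hprob : IsProbabilityMeasure μ01 := ⟨by simp [μ01]⟩
  obtain ⟨hanti, hnn, hae⟩ := rightDeriv_facts hφ
  set h : ℝ → ℝ := fun x => derivWithin φ (Ioi x) x with hh
  set M : ℕ → ℝ≥0∞ := fun n => eLpNorm (g n) ⊤ μ01 with hM
  set a : ℕ → ℝ := fun n => (eLpNorm (g n) 1 μ01 / eLpNorm (g n) ⊤ μ01).toReal with ha
  have hMt : ∀ n, M n ≠ ⊤ := fun n => (hg.2.1 n).ne
  have h1M : ∀ n, eLpNorm (g n) 1 μ01 ≤ M n := fun n =>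
    eLpNorm_le_eLpNorm_of_exponent_le le_top (hg.1 n).aestronglyMeasurable
  have h10 : ∀ n, M n ≠ 0 → eLpNorm (g n) 1 μ01 ≠ 0 := by
    intro n hn h0
    apply hn
    have := (eLpNorm_eq_zero_iff (hg.1 n).aestronglyMeasurable one_ne_zero).1 h0
    exact (eLpNorm_eq_zero_iff (hg.1 n).aestronglyMeasurable top_ne_zero).2 this
  have hdt : ∀ n, eLpNorm (g n) 1 μ01 / M n ≤ 1 := fun n =>
    ENNReal.div_le_of_le_mul (by simpa using h1M n)
  have hdt' : ∀ n, eLpNorm (g n) 1 μ01 / M n ≠ ⊤ := fun n =>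
    ((hdt n).trans_lt ENNReal.one_lt_top).ne
  have ha1 : ∀ n, a n ≤ 1 := fun n => ENNReal.toReal_le_of_le_ofReal zero_le_one
    (by rw [ENNReal.ofReal_one]; exact hdt n)
  have ha0 : ∀ n, M n ≠ 0 → 0 < a n := by
    intro n hn
    exact ENNReal.toReal_pos (ENNReal.div_pos (h10 n hn) (hMt n)).ne' (hdt' n)
  have hMa : ∀ n, M n * ENNReal.ofReal (a n) = eLpNorm (g n) 1 μ01 := by
    intro n
    rw [ha]
    simp only
    rw [ENNReal.ofReal_toReal (hdt' n)]
    rcases eq_or_ne (M n) 0 with h0 | h0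
    · have := h1M n
      rw [h0, nonpos_iff_eq_zero] at this
      rw [this, h0, zero_mul]
    · exact ENNReal.mul_div_cancel h0 (hMt n)
  have hfM : eLpNorm f ⊤ μ01 ≤ ∑' n, M n := by
    rw [eLpNorm_exponent_top]
    refine eLpNormEssSup_le_of_ae_enorm_bound ?_
    have hb : ∀ᵐ x ∂μ01, ∀ n, ENNReal.ofReal (g n x) ≤ M n := by
      rw [ae_all_iff]
      intro n
      simp only [hM, eLpNorm_exponent_top]
      filter_upwards [enorm_ae_le_eLpNormEssSup (g n) μ01] with x hx
      rwa [Real.enorm_of_nonneg (hg.2.2.1 n x)] at hx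
    filter_upwards [hg.2.2.2, hb] with x hx hbx
    rw [Real.enorm_eq_ofReal_abs]
    exact hx.trans (ENNReal.tsum_le_tsum hbx)
  set G : ℝ → ℝ≥0∞ := fun s => ∑' n, (Ioc 0 (a n)).indicator (fun _ => M n) s with hG
  have hGm : Measurable G := by
    refine Measurable.ennreal_tsum fun n => ?_
    exact measurable_const.indicator measurableSet_Ioc
  have hFm : AEMeasurable (fun s => ENNReal.ofReal (decRearr f s))
      (volume.restrict (Ioo (0:ℝ) 1)) :=
    (aemeasurable_restrict_of_antitoneOn measurableSet_Ioo
      ((decRearr_anti hf).mono fun x hx => hx.1)).ennreal_ofReal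
  have hH := hardy_aux hFm hGm.aemeasurable hanti hnn (by
    intro t ht ht1
    refine (decRearr_int hf hg ht ht1).trans ?_
    rw [hG]
    simp only
    rw [lintegral_tsum fun n => (measurable_const.indicator measurableSet_Ioc).aemeasurable]
    refine ENNReal.tsum_le_tsum fun n => ?_
    rw [lintegral_indicator_const measurableSet_Ioc, Measure.restrict_apply measurableSet_Ioc,
      Ioc_inter_Ioc, Real.volume_Ioc]
    simp only [max_self, sub_zero]
    rcases le_total (a n) t with h' | h'
    · rw [min_eq_left h', hMa]; exact min_le_right _ _
    · rw [min_eq_right h', mul_comm]; exact min_le_left _ _)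
  have hint : ∫⁻ s in Ioc (0:ℝ) 1, ENNReal.ofReal (decRearr f s * deriv φ s) ≤
      ∑' n, M n * ∫⁻ s in Ioc 0 (a n), ENNReal.ofReal (deriv φ s) := by
    rw [← restrict_Ioo_eq_restrict_Ioc]
    calc _ = ∫⁻ s in Ioo (0:ℝ) 1, ENNReal.ofReal (decRearr f s) * ENNReal.ofReal (h s) := by
          refine lintegral_congr_ae ?_
          filter_upwards [hae] with s hs
          rw [ENNReal.ofReal_mul (decRearr_nonneg f s), hs]
      _ ≤ _ := hH
      _ = ∫⁻ s in Ioo (0:ℝ) 1, G s * ENNReal.ofReal (deriv φ s) := by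
          refine lintegral_congr_ae ?_
          filter_upwards [hae] with s hs
          rw [hs]
      _ = ∫⁻ s in Ioo (0:ℝ) 1, ∑' n, (Ioc 0 (a n)).indicator
            (fun s => M n * ENNReal.ofReal (deriv φ s)) s := by
          refine lintegral_congr fun s => ?_
          rw [hG]
          simp only
          rw [← ENNReal.tsum_mul_right]
          refine tsum_congr fun n => ?_
          by_cases hs : s ∈ Ioc 0 (a n) <;> simp [hs]
      _ = ∑' n, ∫⁻ s in Ioo (0:ℝ) 1, (Ioc 0 (a n)).indicator
            (fun s => M n * ENNReal.ofReal (deriv φ s)) s := by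
          refine lintegral_tsum fun n => ?_
          exact (((measurable_deriv φ).ennreal_ofReal.const_mul _).indicator
            measurableSet_Ioc).aemeasurable
      _ ≤ _ := by
          refine ENNReal.tsum_le_tsum fun n => ?_
          rw [← lintegral_const_mul _ (measurable_deriv φ).ennreal_ofReal,
            ← lintegral_indicator measurableSet_Ioc]
          exact setLIntegral_le_lintegral _ _
  have hL0 : 0 ≤ limZero φ := by
    refine Real.sInf_nonneg ?_
    rintro _ ⟨y, hy, rfl⟩
    exact (hφ.pos y hy.1 hy.2).le
  unfold lorentzNorm
  calc _ ≤ (∑' n, M n) * ENNReal.ofReal (limZero φ) +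
        ∑' n, M n * ∫⁻ s in Ioc 0 (a n), ENNReal.ofReal (deriv φ s) := by gcongr
    _ = ∑' n, (M n * ENNReal.ofReal (limZero φ) +
        M n * ∫⁻ s in Ioc 0 (a n), ENNReal.ofReal (deriv φ s)) := by
        rw [← ENNReal.tsum_mul_right, ← ENNReal.tsum_add]
    _ ≤ _ := by
        refine ENNReal.tsum_le_tsum fun n => ?_
        rcases eq_or_ne (M n) 0 with h0 | h0
        · simp [h0]
        rw [← mul_add]
        refine mul_le_mul_right ?_ (M n)
        have hle : limZero φ ≤ φ (a n) := by
          refine csInf_le ⟨0, ?_⟩ ⟨a n, ⟨ha0 n h0, ha1 n⟩, rfl⟩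
          rintro _ ⟨y, hy, rfl⟩
          exact (hφ.pos y hy.1 hy.2).le
        refine (add_le_add_right (deriv_int hφ (ha0 n h0) (ha1 n)) _).trans ?_
        rw [← ENNReal.ofReal_add hL0 (by linarith)]
        exact ENNReal.ofReal_le_ofReal (by linarith)

/-- `QA_{φ,ψ} ↪ Λ_φ` with embedding norm at most `1/ψ(1)`:
`ψ(1) ‖f‖_{Λ_φ} ≤ ‖f‖_{φ,ψ}` for every measurable `f`. -/
theorem stmt10 {φ ψ : ℝ → ℝ} (hφ : IsPhi φ) (hψ : IsPsi ψ)
    (f : ℝ → ℝ) (hf : AEMeasurable f μ01) :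
    ENNReal.ofReal (ψ 1) * lorentzNorm φ f ≤ QANorm φ ψ f := by
  refine le_iInf₂ fun g hg => ?_
  refine (mul_le_mul_right (lorentz_le hφ hf hg) _).trans ?_
  rw [← ENNReal.tsum_mul_left]
  refine ENNReal.tsum_le_tsum fun n => ?_
  have hp : ψ 1 ≤ ψ ((n:ℝ) + 1) := by
    have hn : (0:ℝ) ≤ n := Nat.cast_nonneg n
    exact hψ.mono (by simp) (by simp only [mem_Ici]; linarith) (by linarith)
  have h1 : 0 < ψ 1 := hψ.pos 1 one_pos
  rw [ENNReal.ofReal_mul (mul_nonneg (by linarith) ENNReal.toReal_nonneg),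
    ENNReal.ofReal_mul (by linarith),
    ENNReal.ofReal_toReal (hg.2.1 n).ne, mul_assoc]
  gcongr
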